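/- arXiv:1307.5400 — 2 statements merged into one kernel-verified Lean document; each statement's English description precedes it below -/
import Mathlib

section
/- Let Δ be a finite acyclic quiver, X a finite-dimensional representation with dimension vector x, and M a representation such that for some ring E acting on M by endomorphisms of the representation, each M_i has finite length d_i as an E-module. If Σ_i x_i d_i − Σ_α x_{s(α)} d_{t(α)} > 0, then Hom_Δ(X, M) ≠ 0. -/
/-- A finite quiver: finite sets of vertices and arrows with source and target maps. -/
structure FinQuiver where
  V : Type
  A : Type
  [fintypeV : Fintype V]
  [fintypeA : Fintype A]
  [decEqV : DecidableEq V]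
  s : A → V
  t : A → V

attribute [instance] FinQuiver.fintypeV FinQuiver.fintypeA FinQuiver.decEqV

/-- A finite quiver is acyclic (has no oriented cycles) iff its vertices admit a
grading strictly increasing along arrows. -/
def FinQuiver.Acyclic (Q : FinQuiver) : Prop :=
  ∃ f : Q.V → ℕ, ∀ a : Q.A, f (Q.s a) < f (Q.t a)

/-- A representation of a quiver over a field `k`: a vector space at each vertex and a
linear map along each arrow. -/
structure QRep (k : Type) [Field k] (Q : FinQuiver) where
  M : Q.V → Type
  [acg : ∀ i, AddCommGroup (M i)]
  [mod : ∀ i, Module k (M i)]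
  map : ∀ a : Q.A, M (Q.s a) →ₗ[k] M (Q.t a)

attribute [instance] QRep.acg QRep.mod

variable {k : Type} [Field k] {Q : FinQuiver}

/-- The space of homomorphisms of representations `X → M`, as a subspace of
`Π i, Hom_k(X_i, M_i)`: the families commuting with all arrow maps. -/
def homSet (X M : QRep k Q) : Submodule k (∀ i, X.M i →ₗ[k] M.M i) where
  carrier := {f | ∀ a, (f (Q.t a)).comp (X.map a) = (M.map a).comp (f (Q.s a))}
  add_mem' := by
    intro f g hf hg a
    ext x
    simp only [Pi.add_apply, LinearMap.add_comp, LinearMap.comp_add, hf a, hg a]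
  zero_mem' := by intro a; ext x; simp
  smul_mem' := by
    intro c f hf a
    ext x
    simp
    rw [← LinearMap.comp_apply, hf a]; simp

/-- The (Jordan–Hölder) length of a module: the supremum of the lengths of chains of
submodules. -/
noncomputable def mlength (R M : Type*) [Ring R] [AddCommGroup M] [Module R M] : ℕ∞ :=
  Order.height (⊤ : Submodule R M)

/-- The dimension vector of a representation. -/
noncomputable def dimVec (X : QRep k Q) : Q.V → ℤ :=
  fun i => (Module.finrank k (X.M i) : ℤ)

/-- If `P + t Q` is injective, then the pencil `P + x Q` has no nonzero polynomial solution: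
a finitely supported sequence of coefficients of a solution vanishes. -/
theorem eq_zero_of_pencil_solution {R U V : Type*} [CommRing R] [AddCommGroup U] [AddCommGroup V]
    [Module R U] [Module R V] (P Q : U →ₗ[R] V) (t : R)
    (hinj : ∀ u, P u + t • Q u = 0 → u = 0) (N : ℕ) (b : ℕ → U)
    (hb : ∀ j, N ≤ j → b j = 0) (h0 : P (b 0) = 0)
    (hrec : ∀ j, P (b (j + 1)) + Q (b j) = 0) (j : ℕ) : b j = 0 := by
  induction N generalizing b j with
  | zero => exact hb j (Nat.zero_le j)
  | succ N ih =>
    let c : ℕ → U := fun j => ∑ i ∈ Finset.range (N + 1), t ^ i • b (j + i)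
    have hc : ∀ j, b j = c j - t • c (j + 1) := by
      intro j
      have h1 := Finset.sum_range_succ (fun i => t ^ i • b (j + i)) (N + 1)
      rw [Finset.sum_range_succ', hb (j + (N + 1)) (by omega)] at h1
      have h2 : t • c (j + 1) = ∑ i ∈ Finset.range (N + 1), t ^ (i + 1) • b (j + (i + 1)) := by
        simp only [c, Finset.smul_sum]
        refine Finset.sum_congr rfl fun i _ => ?_
        rw [smul_smul, ← pow_succ', show j + 1 + i = j + (i + 1) by omega]
      rw [h2]
      simp only [pow_zero, one_smul, add_zero, smul_zero] at h1
      change b j = (∑ i ∈ Finset.range (N + 1), t ^ i • b (j + i)) - _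
      rw [← h1]
      abel
    have hc0 : ∀ j, N + 1 ≤ j → c j = 0 := fun j hj =>
      Finset.sum_eq_zero fun i _ => by rw [hb _ (by omega), smul_zero]
    have hg : ∀ m j, N + 1 ≤ j + m → P (c (j + 1)) + Q (c j) = 0 := by
      intro m
      induction m with
      | zero => intro j hj; rw [hc0 j hj, hc0 (j + 1) (by omega)]; simp
      | succ m ihm =>
        intro j hj
        have h1 := hrec j
        have h2 := ihm (j + 1) (by omega)
        rw [hc j, hc (j + 1)] at h1
        simp only [map_sub, map_smul] at h1
        have h3 : P (c (j + 1)) + Q (c j) =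
            (P (c (j + 1)) - t • P (c (j + 1 + 1)) + (Q (c j) - t • Q (c (j + 1)))) +
              t • (P (c (j + 1 + 1)) + Q (c (j + 1))) := by
          rw [smul_add]; abel
        rw [h3, h1, h2, smul_zero, add_zero]
    have hgc : ∀ j, P (c (j + 1)) + Q (c j) = 0 := fun j => hg (N + 1) j (by omega)
    have hz : c 0 = 0 := by
      refine hinj _ ?_
      have h1 := hgc 0
      rw [hc 0, map_sub, map_smul, eq_neg_of_add_eq_zero_left h1, smul_neg, sub_neg_eq_add] at h0
      exact h0
    have hs : ∀ j, c (j + 1) = 0 := fun j => by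
      refine ih (fun j => c (j + 1)) (fun j hj => hc0 _ (by omega)) ?_ (fun j => hgc (j + 1)) j
      simpa [hz] using hgc 0
    cases j with
    | zero => rw [hc 0, hz, hs 0, smul_zero, sub_zero]
    | succ j => rw [hc (j + 1), hs j, hs (j + 1), smul_zero, sub_zero]

/-- The `n`-th coordinate of a vector of length `N`, read as `0` when `N ≤ n`. -/
def coordOrZero (R U : Type*) [Semiring R] [AddCommMonoid U] [Module R U] (N n : ℕ) :
    (Fin N → U) →ₗ[R] U :=
  if h : n < N then LinearMap.proj ⟨n, h⟩ else 0

theorem coordOrZero_of_lt {R U : Type*} [Semiring R] [AddCommMonoid U] [Module R U] {N n : ℕ}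
    (h : n < N) (b : Fin N → U) : coordOrZero R U N n b = b ⟨n, h⟩ := by
  simp [coordOrZero, h]

theorem coordOrZero_of_le {R U : Type*} [Semiring R] [AddCommMonoid U] [Module R U] {N n : ℕ}
    (h : N ≤ n) (b : Fin N → U) : coordOrZero R U N n b = 0 := by
  simp [coordOrZero, not_lt.mpr h]

theorem coordOrZero_smul {R E U : Type*} [Semiring R] [Semiring E] [AddCommMonoid U] [Module R U]
    [Module E U] {N n : ℕ} (e : E) (b : Fin N → U) :
    coordOrZero R U N n (e • b) = e • coordOrZero R U N n b := by
  by_cases h : n < N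
  · simp [coordOrZero_of_lt h]
  · simp [coordOrZero_of_le (not_lt.mp h)]

/-- Suppose `R` and `E` both act on `U` and `V`, not necessarily compatibly, and the `E`-length
of `U` exceeds that of `V`. Then an `R`-linear combination of maps that are both `R`-linear and
`E`-linear is not injective, although it need not be `E`-linear. -/
theorem exists_ne_zero_combination_eq_zero {R E ι : Type*} [CommRing R] [Ring E] (t : ι → R)
    (s : Finset ι) {U V : Type*} [AddCommGroup U] [AddCommGroup V] [Module R U] [Module R V]
    [Module E U] [Module E V] (T₀ : U →ₗ[R] V) (T : ι → U →ₗ[R] V)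
    (hT₀ : ∀ (e : E) u, T₀ (e • u) = e • T₀ u) (hT : ∀ i (e : E) u, T i (e • u) = e • T i u)
    (m n : ℕ) (hU : Module.length E U = m) (hV : Module.length E V = n) (hlt : n < m) :
    ∃ u, u ≠ 0 ∧ T₀ u + ∑ i ∈ s, t i • T i u = 0 := by
  classical
  induction s using Finset.induction_on generalizing U V m n with
  | empty =>
    by_contra! hcon
    let T' : U →ₗ[E] V := { toFun := T₀, map_add' := map_add T₀, map_smul' := hT₀ }
    have hinj : Function.Injective T' := by
      rw [injective_iff_map_eq_zero]
      intro u hu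
      by_contra hne
      exact hcon u hne (by rw [Finset.sum_empty, add_zero]; exact hu)
    have hle := Module.length_le_of_injective T' hinj
    rw [hU, hV] at hle
    exact absurd (by exact_mod_cast hle) (not_le.mpr hlt)
  | insert a s ha ih =>
    let N := n + 1
    let S (L : U →ₗ[R] V) : (Fin N → U) →ₗ[R] (Fin (N + 1) → V) :=
      LinearMap.pi fun j => L ∘ₗ coordOrZero R U N j
    let Q : (Fin N → U) →ₗ[R] (Fin (N + 1) → V) :=
      LinearMap.pi (Fin.cases 0 fun j => T a ∘ₗ coordOrZero R U N j)
    have hS : ∀ L : U →ₗ[R] V, (∀ (e : E) u, L (e • u) = e • L u) →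
        ∀ (e : E) b, S L (e • b) = e • S L b := by
      intro L hL e b
      ext j
      simp [S, coordOrZero_smul, hL]
    have hQ : ∀ (e : E) b, Q (e • b) = e • Q b := by
      intro e b
      ext j
      refine Fin.cases ?_ (fun j => ?_) j
      · simp [Q]
      · simp [Q, coordOrZero_smul, hT]
    obtain ⟨b, hb, hsol⟩ := ih (S T₀ + Q) (fun i => S (T i))
      (fun e b => by simp [hS _ hT₀, hQ]) (fun i => hS _ (hT i))
      (N * m) ((N + 1) * n) (by simp [hU]) (by simp [hV])
      (by simp only [N]; nlinarith)
    let P : U →ₗ[R] V := T₀ + ∑ i ∈ s, t i • T i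
    have hcoef : ∀ j : Fin (N + 1), P (coordOrZero R U N j b) + Q b j = 0 := by
      intro j
      have h := congrFun hsol j
      simp only [S, LinearMap.add_apply, Pi.add_apply, LinearMap.pi_apply, LinearMap.comp_apply,
        Finset.sum_apply, Pi.smul_apply, Pi.zero_apply] at h
      simp only [P, LinearMap.add_apply, LinearMap.sum_apply, LinearMap.smul_apply]
      rw [← h]
      abel
    by_contra! hcon
    refine hb (funext fun j => ?_)
    rw [← coordOrZero_of_lt (R := R) j.2 b]
    refine eq_zero_of_pencil_solution P (T a) (t a) (fun u hu => ?_) N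
      (fun j => coordOrZero R U N j b) (fun j hj => coordOrZero_of_le hj b) ?_ (fun j => ?_) j
    · by_contra hne
      refine hcon u hne ?_
      rw [Finset.sum_insert ha, ← hu]
      simp only [P, LinearMap.add_apply, LinearMap.sum_apply, LinearMap.smul_apply]
      abel
    · simpa [Q] using hcoef 0
    · rcases lt_or_ge j N with hj | hj
      · simpa [Q] using hcoef (Fin.succ ⟨j, hj⟩)
      · simp only [coordOrZero_of_le hj b, coordOrZero_of_le (Nat.le_succ_of_le hj) b, map_zero,
          add_zero]

/-- if a ring `E` acts on `M` by endomorphisms of the representation, each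
`M_i` having finite `E`-length `d_i`, and `Σ x_i d_i - Σ_α x_{s α} d_{t α} > 0`, then
`Hom_Δ(X, M) ≠ 0`. -/
theorem hom_ne_zero_of_euler_pos (k : Type) [Field k] (Q : FinQuiver) (hQ : Q.Acyclic)
    (X M : QRep k Q) [∀ i, FiniteDimensional k (X.M i)]
    (E : Type) [Ring E] [∀ i, Module E (M.M i)]
    (hE : ∀ (a : Q.A) (e : E) (x : M.M (Q.s a)), M.map a (e • x) = e • M.map a x)
    (d : Q.V → ℕ) (hd : ∀ i, mlength E (M.M i) = (d i : ℕ∞))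
    (hpos : 0 < (∑ i : Q.V, dimVec X i * (d i : ℤ)) -
      ∑ a : Q.A, dimVec X (Q.s a) * (d (Q.t a) : ℤ)) :
    homSet X M ≠ ⊥ := by
  classical
  let B (i : Q.V) := Module.finBasis k (X.M i)
  let x (i : Q.V) : ℕ := Module.finrank k (X.M i)
  have hlen : ∀ i, Module.length E (M.M i) = d i := fun i => by
    rw [← hd i, mlength, Module.length_eq_height]
  let ι := Σ a : Q.A, Fin (x (Q.t a)) × Fin (x (Q.s a))
  let T₀ : (∀ i : Q.V, Fin (x i) → M.M i) →ₗ[k] (∀ a : Q.A, Fin (x (Q.s a)) → M.M (Q.t a)) :=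
    LinearMap.pi fun a => LinearMap.pi fun q =>
      -(M.map a ∘ₗ LinearMap.proj q ∘ₗ LinearMap.proj (Q.s a))
  let T (c : ι) :
      (∀ i : Q.V, Fin (x i) → M.M i) →ₗ[k] (∀ a : Q.A, Fin (x (Q.s a)) → M.M (Q.t a)) :=
    LinearMap.single k (fun a : Q.A => Fin (x (Q.s a)) → M.M (Q.t a)) c.1 ∘ₗ
      LinearMap.single k (fun _ : Fin (x (Q.s c.1)) => M.M (Q.t c.1)) c.2.2 ∘ₗ
        LinearMap.proj c.2.1 ∘ₗ LinearMap.proj (Q.t c.1)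
  have hT₀ : ∀ u a q, T₀ u a q = -M.map a (u (Q.s a) q) := fun _ _ _ => rfl
  have hT : ∀ c u, T c u = Pi.single c.1 (Pi.single c.2.2 (u (Q.t c.1) c.2.1)) :=
    fun _ _ => rfl
  let t (c : ι) : k := (B (Q.t c.1)).repr (X.map c.1 (B (Q.s c.1) c.2.2)) c.2.1
  obtain ⟨u, hu, hsol⟩ := exists_ne_zero_combination_eq_zero (E := E) t Finset.univ T₀ T
    (fun e u => by ext a q; simp [hT₀, hE])
    (fun c e u => by simp [hT, Pi.single_smul])
    (∑ i, x i * d i) (∑ a, x (Q.s a) * d (Q.t a))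
    (by simp [Module.length_pi_of_fintype, hlen])
    (by simp [Module.length_pi_of_fintype, hlen])
    (by
      have h := sub_pos.mp hpos
      simp only [dimVec] at h
      exact_mod_cast h)
  have hcoef : ∀ a q, ∑ p, t ⟨a, p, q⟩ • u (Q.t a) p = M.map a (u (Q.s a) q) := by
    intro a q
    have h := congrFun (congrFun hsol a) q
    rw [Fintype.sum_sigma] at h
    simp only [Pi.add_apply, Finset.sum_apply, Pi.smul_apply, Pi.zero_apply, hT₀, hT] at h
    rw [Finset.sum_eq_single a (fun b _ hba => by simp [Pi.single_eq_of_ne hba.symm])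
      (by simp), Fintype.sum_prod_type] at h
    simp only [Pi.single_eq_same, Pi.single_apply, smul_ite, smul_zero, Finset.sum_ite_eq,
      Finset.mem_univ, if_true] at h
    exact (neg_add_eq_zero.mp h).symm
  let f : ∀ i, X.M i →ₗ[k] M.M i := fun i => (B i).constr k (u i)
  have hf : f ∈ homSet X M := by
    intro a
    refine (B (Q.s a)).ext fun q => ?_
    simp only [LinearMap.comp_apply, f, Module.Basis.constr_basis]
    rw [← hcoef, Module.Basis.constr_apply_fintype]
    rfl
  intro hbot
  rw [hbot, Submodule.mem_bot] at hf
  refine hu (funext fun i => funext fun p => ?_)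
  have h := LinearMap.congr_fun (congrFun hf i) (B i p)
  simp only [f, Module.Basis.constr_basis] at h
  exact h
end

section
/- Let Λ be a finite-dimensional hereditary algebra and M an endo-finite Λ-module. Then M is a direct sum of copies of finitely many indecomposable endo-finite Λ-modules N₁, …, N_t. -/
/-- A ring is (left) hereditary if submodules of projective modules are projective. -/
def IsHereditaryRing (L : Type) [Ring L] : Prop :=
  ∀ (P : Type) (_ : AddCommGroup P) (_ : Module L P),
    Module.Projective L P → ∀ N : Submodule L P, Module.Projective L N

/-- A module is indecomposable if it is nonzero and its endomorphism ring has no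
nontrivial idempotents. -/
def ModIndec (L N : Type) [Ring L] [AddCommGroup N] [Module L N] : Prop :=
  Nontrivial N ∧ ∀ e : Module.End L N, e * e = e → e = 0 ∨ e = 1

/-- A subset of a module which is empty or a coset of a submodule. -/
def IsLinearCoset (R : Type*) [Ring R] {A : Type*} [AddCommGroup A] [Module R A]
    (C : Set A) : Prop :=
  ∃ Y : Submodule R A, ∀ f ∈ C, ∀ g, g ∈ C ↔ g - f ∈ Y

/-- A filter on a module with a basis of cosets of submodules. -/
def IsLinearFilter (R : Type*) [Ring R] {A : Type*} [AddCommGroup A] [Module R A]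
    (F : Filter A) : Prop :=
  ∀ s ∈ F, ∃ t ∈ F, t ⊆ s ∧ IsLinearCoset R t

section LinearCompactness

variable {R A Q : Type*} [Ring R] [AddCommGroup A] [Module R A] [AddCommGroup Q] [Module R Q]

open Filter

lemma IsLinearCoset.inter {C D : Set A} (hC : IsLinearCoset R C) (hD : IsLinearCoset R D) :
    IsLinearCoset R (C ∩ D) := by
  obtain ⟨Y, hY⟩ := hC
  obtain ⟨Z, hZ⟩ := hD
  refine ⟨Y ⊓ Z, fun f hf g => ?_⟩
  rw [Set.mem_inter_iff, hY f hf.1 g, hZ f hf.2 g, Submodule.mem_inf]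

lemma IsLinearCoset.biInter {ι : Type*} {C : ι → Set A} (hC : ∀ i, IsLinearCoset R (C i))
    (s : Set ι) : IsLinearCoset R (⋂ i ∈ s, C i) := by
  choose Y hY using hC
  refine ⟨⨅ i ∈ s, Y i, fun f hf g => ?_⟩
  simp only [Set.mem_iInter, Submodule.mem_iInf] at hf ⊢
  exact forall₂_congr fun i hi => hY i f (hf i hi) g

lemma IsLinearCoset.preimage {C : Set Q} (hC : IsLinearCoset R C) (ev : A →ₗ[R] Q) :
    IsLinearCoset R (ev ⁻¹' C) := by
  obtain ⟨Y, hY⟩ := hC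
  refine ⟨Y.comap ev, fun f hf g => ?_⟩
  rw [Set.mem_preimage, hY _ hf, Submodule.mem_comap, map_sub]

lemma isLinearCoset_singleton (v : A) : IsLinearCoset R {v} :=
  ⟨⊥, fun f hf g => by simp_all [sub_eq_zero]⟩

lemma IsLinearFilter.inf_principal {F : Filter A} (hF : IsLinearFilter R F) {C : Set A}
    (hC : IsLinearCoset R C) : IsLinearFilter R (F ⊓ 𝓟 C) := by
  intro s hs
  obtain ⟨t, ht, hts, htl⟩ := hF _ (mem_inf_principal.1 hs)
  refine ⟨t ∩ C, inter_mem_inf ht (mem_principal_self C), fun x hx => hts hx.1 hx.2, htl.inter hC⟩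

lemma IsLinearFilter.exists_inf_fiber_neBot [IsArtinian R Q] {F : Filter A} [F.NeBot]
    (hF : IsLinearFilter R F) (ev : A →ₗ[R] Q) :
    ∃ v, (F ⊓ 𝓟 (ev ⁻¹' {v})).NeBot := by
  obtain ⟨Y, ⟨v, hv⟩, hmin⟩ := WellFounded.has_min (wellFounded_lt (α := Submodule R Q))
    {Y | ∃ v, {f | ev f - v ∈ Y} ∈ F} ⟨⊤, 0, by simp⟩
  refine ⟨v, inf_principal_neBot_iff.2 fun s hs => ?_⟩
  obtain ⟨t, ht, hts, I, hI⟩ := hF _ (inter_mem hs hv)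
  obtain ⟨f, hf⟩ := nonempty_of_mem ht
  have hle : I.map ev ≤ Y := by
    rintro _ ⟨i, hi, rfl⟩
    have h1 : ev (f + i) - v ∈ Y := (hts ((hI f hf (f + i)).2 (by simpa using hi))).2
    have h2 : ev f - v ∈ Y := (hts hf).2
    simpa using Y.sub_mem h1 h2
  have hmem : I.map ev ∈ {Y | ∃ v, {f | ev f - v ∈ Y} ∈ F} := by
    refine ⟨ev f, mem_of_superset ht fun g hg => ?_⟩
    exact ⟨g - f, (hI f hf g).1 hg, map_sub ev g f⟩
  have heq : I.map ev = Y := hle.eq_of_not_lt (hmin _ hmem)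
  have h2 : ev f - v ∈ Y := (hts hf).2
  rw [← heq] at h2
  obtain ⟨i, hi, hiv⟩ := h2
  refine ⟨f - i, (hts ((hI f hf _).2 (by simpa using hi))).1, ?_⟩
  simp [hiv]

lemma IsLinearFilter.exists_minimal {F : Filter A} [F.NeBot] (hF : IsLinearFilter R F) :
    ∃ G ≤ F, Minimal (fun G => G.NeBot ∧ IsLinearFilter R G) G := by
  suffices H : ∀ c : Set (Filter A), (∀ G ∈ c, G.NeBot ∧ IsLinearFilter R G) →
      DirectedOn (· ≥ ·) c → c.Nonempty → (sInf c).NeBot ∧ IsLinearFilter R (sInf c) from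
    @zorn_le_nonempty₀ (Filter A)ᵒᵈ _ {G : Filter A | G.NeBot ∧ IsLinearFilter R G}
      (fun c hc hchain G₀ hG₀ => ⟨(sInf (α := Filter A) c : Filter A),
        H c hc (fun x hx y hy => (hchain.total hx hy).elim
          (fun h => ⟨y, hy, h, le_rfl⟩) fun h => ⟨x, hx, le_rfl, h⟩) ⟨G₀, hG₀⟩,
        fun z hz => sInf_le (α := Filter A) hz⟩) F ⟨‹_›, hF⟩
  intro c hc hdir hne
  refine ⟨sInf_neBot_of_directed' hne hdir fun h => (hc _ h).1.ne rfl, fun s hs => ?_⟩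
  have := hne.to_subtype
  rw [sInf_eq_iInf', mem_iInf_of_directed hdir.directed_val] at hs
  obtain ⟨⟨G, hG⟩, hsG⟩ := hs
  obtain ⟨t, ht, h⟩ := (hc G hG).2 s hsG
  exact ⟨t, sInf_le hG ht, h⟩

end LinearCompactness

/-- The endomorphism ring of a module which is artinian over it is linearly compact for the
topology of pointwise convergence. -/
lemma Module.End.exists_forall_mem_of_finset {L M : Type*} [Ring L] [AddCommGroup M] [Module L M]
    [IsArtinian (Module.End L M) M] {ι : Type*} (m : ι → M) (C : ι → Set M)
    (hC : ∀ i, IsLinearCoset (Module.End L M) (C i))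
    (hfin : ∀ s : Finset ι, ∃ f : Module.End L M, ∀ i ∈ s, f (m i) ∈ C i) :
    ∃ f : Module.End L M, ∀ i, f (m i) ∈ C i := by
  open Filter in
  let E := Module.End L M
  let ev (x : M) : E →ₗ[E] M := LinearMap.toSpanSingleton E M x
  have ev_apply (x : M) (f : E) : ev x f = f x := rfl
  let F : Filter E := ⨅ i, 𝓟 (ev (m i) ⁻¹' C i)
  have hbasis := hasBasis_iInf_principal_finite fun i => ev (m i) ⁻¹' C i
  have hFne : F.NeBot := hbasis.neBot_iff.2 fun {s} hs => by
    obtain ⟨f, hf⟩ := hfin hs.toFinset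
    exact ⟨f, by simpa [ev_apply] using hf⟩
  have hFlin : IsLinearFilter E F := fun s hs => by
    obtain ⟨t, ht, hts⟩ := hbasis.mem_iff.1 hs
    exact ⟨_, hbasis.mem_of_mem ht, hts,
      IsLinearCoset.biInter (fun i => (hC i).preimage (ev (m i))) t⟩
  obtain ⟨G, hGF, ⟨hGne, hGlin⟩, hGmin⟩ := hFlin.exists_minimal
  have key (x : M) : ∃ v, ev x ⁻¹' {v} ∈ G := by
    obtain ⟨v, hv⟩ := hGlin.exists_inf_fiber_neBot (ev x)
    refine ⟨v, le_principal_iff.1 ((hGmin ⟨hv, ?_⟩ inf_le_left).trans inf_le_right)⟩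
    exact hGlin.inf_principal ((isLinearCoset_singleton v).preimage (ev x))
  choose g hg using key
  let f : E :=
    { toFun := g
      map_add' := fun x y => by
        obtain ⟨h, ⟨h1, h2⟩, h3⟩ := nonempty_of_mem
          (inter_mem (inter_mem (hg x) (hg y)) (hg (x + y)))
        simp only [Set.mem_preimage, Set.mem_singleton_iff, ev_apply] at h1 h2 h3
        rw [← h1, ← h2, ← h3, map_add]
      map_smul' := fun r x => by
        obtain ⟨h, h1, h2⟩ := nonempty_of_mem (inter_mem (hg x) (hg (r • x)))
        simp only [Set.mem_preimage, Set.mem_singleton_iff, ev_apply] at h1 h2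
        rw [← h1, ← h2, map_smul, RingHom.id_apply] }
  refine ⟨f, fun i => ?_⟩
  have hi : ev (m i) ⁻¹' C i ∈ G := hGF (mem_iInf_of_mem i (mem_principal_self _))
  obtain ⟨h, h1, h2⟩ := nonempty_of_mem (inter_mem hi (hg (m i)))
  simp only [Set.mem_preimage, Set.mem_singleton_iff, ev_apply] at h1 h2
  change g (m i) ∈ C i
  rwa [← h2]

/-- The Jacobson density theorem for a finite family of pairwise non-isomorphic simple modules. -/
lemma jacobson_density_pi {R T : Type*} [Ring R] [Finite T] {S : T → Type*}
    [∀ c, AddCommGroup (S c)] [∀ c, Module R (S c)] [∀ c, IsSimpleModule R (S c)]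
    (hne : ∀ c c', c ≠ c' → IsEmpty (S c ≃ₗ[R] S c'))
    (φ : ∀ c, Module.End (Module.End R (S c)) (S c)) (s : Finset (Σ c, S c)) :
    ∃ r : R, ∀ i ∈ s, φ i.1 i.2 = r • i.2 := by
  classical
  have := Fintype.ofFinite T
  let f : Module.End (Module.End R (∀ c, S c)) (∀ c, S c) :=
    { toFun := fun x c => φ c (x c)
      map_add' := fun x y => by ext c; exact map_add (φ c) _ _
      map_smul' := fun d x => by
        ext c
        let δ (c' : T) : S c' →ₗ[R] S c := LinearMap.proj c ∘ₗ d ∘ₗ LinearMap.single R S c'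
        have hδ (c' : T) (h : c' ≠ c) : δ c' = 0 :=
          (LinearMap.bijective_or_eq_zero (δ c')).resolve_left fun hb =>
            (hne _ _ h).false (LinearEquiv.ofBijective _ hb)
        have hd (x : ∀ c, S c) : d x c = δ c (x c) := by
          conv_lhs => rw [← Finset.univ_sum_single x, map_sum, Finset.sum_apply]
          refine Finset.sum_eq_single c (fun c' _ h => ?_) (by simp)
          exact congr($(hδ c' h) (x c'))
        simp only [Module.End.smul_def, RingHom.id_apply, hd]
        exact (φ c).map_smul (δ c) (x c) }
  obtain ⟨r, hr⟩ := jacobson_density f (s.image fun i : Σ c, S c => (Pi.single i.1 i.2 : ∀ c, S c))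
  refine ⟨r, fun i hi => ?_⟩
  simpa [f] using congr_fun (hr _ (Finset.mem_image_of_mem _ hi)) i.1

/-- The subquotient `X / (X ∩ Y)` of a module. -/
abbrev Subquotient {R M : Type*} [Ring R] [AddCommGroup M] [Module R M]
    (X Y : Submodule R M) : Type _ :=
  ↥X ⧸ Y.comap X.subtype

lemma Module.End.exists_smul_eq_of_subquotient {L M : Type*} [Ring L] [AddCommGroup M] [Module L M]
    [IsArtinian (Module.End L M) M] {T : Type*} [Finite T]
    (X Y : T → Submodule (Module.End L M) M)
    [∀ c, IsSimpleModule (Module.End L M) (Subquotient (X c) (Y c))]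
    (hne : ∀ c c', c ≠ c' → IsEmpty
      (Subquotient (X c) (Y c) ≃ₗ[Module.End L M] Subquotient (X c') (Y c')))
    (φ : ∀ c, Module.End (Module.End (Module.End L M) (Subquotient (X c) (Y c)))
      (Subquotient (X c) (Y c))) :
    ∃ r : Module.End L M, ∀ c (q : Subquotient (X c) (Y c)), r • q = φ c q := by
  classical
  choose w hw using fun (i : Σ c, ↥(X c)) => Submodule.mkQ_surjective _ (φ i.1 (Submodule.mkQ _ i.2))
  obtain ⟨r, hr⟩ := Module.End.exists_forall_mem_of_finset (L := L)
    (fun i : Σ c, ↥(X c) => (i.2 : M)) (fun i => {z | z - w i ∈ Y i.1 ⊓ X i.1})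
    (fun i => ⟨Y i.1 ⊓ X i.1, fun a ha b => by
      simp only [Set.mem_ofPred_eq] at ha ⊢
      rw [← (Y i.1 ⊓ X i.1).sub_mem_iff_left ha, sub_sub_sub_cancel_right]⟩)
    (fun s => by
      let g (i : Σ c, ↥(X c)) : Σ c, Subquotient (X c) (Y c) := ⟨i.1, Submodule.mkQ _ i.2⟩
      obtain ⟨r, hr⟩ := jacobson_density_pi hne φ (s.image g)
      refine ⟨r, fun i hi => ?_⟩
      have h : φ i.1 (Submodule.mkQ _ i.2) = r • Submodule.mkQ _ i.2 :=
        hr _ (Finset.mem_image_of_mem g hi)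
      rw [← hw i, ← map_smul, eq_comm, ← sub_eq_zero, ← map_sub] at h
      have hY := (Submodule.Quotient.mk_eq_zero _).1 h
      exact ⟨hY, (r • i.2 - w i).2⟩)
  refine ⟨r, fun c q => ?_⟩
  obtain ⟨x, rfl⟩ := Submodule.mkQ_surjective _ q
  rw [← hw ⟨c, x⟩, ← map_smul, ← sub_eq_zero, ← map_sub]
  exact (Submodule.Quotient.mk_eq_zero _).2 (hr ⟨c, x⟩).1

section RowDecomposition

variable {R : Type*} [Ring R] {T : Type*} [Fintype T] {κ : T → Type*}

/-- The sum `∑ u c b • y c b` of a finitely supported family `y`. -/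
noncomputable def rowSum (u : ∀ c, κ c → R) (X : Type*) [AddCommGroup X] [Module R X] :
    (∀ c, κ c →₀ X) →+ X :=
  ∑ c, (Finsupp.liftAddHom fun b => DistribSMul.toAddMonoidHom X (u c b)).comp
    (Pi.evalAddMonoidHom _ c)

lemma rowSum_apply (u : ∀ c, κ c → R) {X : Type*} [AddCommGroup X] [Module R X]
    (y : ∀ c, κ c →₀ X) : rowSum u X y = ∑ c, (y c).sum fun b x => u c b • x := by
  simp [rowSum, AddMonoidHom.finsetSum_apply]
  rfl

lemma rowSum_mapRange (u : ∀ c, κ c → R) {X X' : Type*} [AddCommGroup X] [Module R X]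
    [AddCommGroup X'] [Module R X'] (f : X →ₗ[R] X') (y : ∀ c, κ c →₀ X) :
    rowSum u X' (fun c => (y c).mapRange f f.map_zero) = f (rowSum u X y) := by
  simp only [rowSum_apply, map_sum, map_finsuppSum, map_smul]
  exact Finset.sum_congr rfl fun c _ => Finsupp.sum_mapRange_index (by simp)

/-- The module `X` is, as an abelian group, the direct sum of the translates `u c b • e c • X`,
and multiplication by `u c b` is injective on `e c • X`. -/
structure HasRowDecomposition (e : T → R) (u : ∀ c, κ c → R) (X : Type*) [AddCommGroup X]
    [Module R X] : Prop where
  surj : ∀ x, ∃ y : ∀ c, κ c →₀ X, (∀ c b, e c • y c b = y c b) ∧ rowSum u X y = x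
  inj : ∀ y : ∀ c, κ c →₀ X, (∀ c b, e c • y c b = y c b) → rowSum u X y = 0 → y = 0

variable {e : T → R} {u : ∀ c, κ c → R} {X A B : Type*} [AddCommGroup X] [Module R X]
  [AddCommGroup A] [Module R A] [AddCommGroup B] [Module R B]

lemma HasRowDecomposition.of_subsingleton [Subsingleton X] : HasRowDecomposition e u X where
  surj _ := ⟨0, fun _ _ => Subsingleton.elim _ _, Subsingleton.elim _ _⟩
  inj _ _ _ := Subsingleton.elim _ _

lemma HasRowDecomposition.of_exact (he : ∀ c, e c * e c = e c) (hA : HasRowDecomposition e u A)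
    (hB : HasRowDecomposition e u B) (f : A →ₗ[R] X) (g : X →ₗ[R] B)
    (hf : Function.Injective f) (hg : Function.Surjective g) (hfg : Function.Exact f g) :
    HasRowDecomposition e u X where
  surj x := by
    obtain ⟨z, hz, hzx⟩ := hB.surj (g x)
    choose y hy using fun c => Finsupp.mapRange_surjective g g.map_zero hg (z c)
    let y' : ∀ c, κ c →₀ X := fun c => (y c).mapRange (e c • ·) (smul_zero _)
    have hy' : (fun c => (y' c).mapRange g g.map_zero) = z := by
      ext c b
      have h := hz c b
      rw [← hy c] at h
      simpa [y', ← hy c] using h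
    obtain ⟨a, ha⟩ := (hfg (x - rowSum u X y')).1 (by
      rw [map_sub, ← rowSum_mapRange, hy', hzx, sub_self])
    obtain ⟨w, hw, rfl⟩ := hA.surj a
    refine ⟨y' + fun c => (w c).mapRange f f.map_zero, fun c b => ?_, ?_⟩
    · simp [y', smul_smul, he, ← map_smul, hw]
    · rw [map_add, rowSum_mapRange, ha, add_sub_cancel]
  inj y hy h0 := by
    have h1 := hB.inj (fun c => (y c).mapRange g g.map_zero)
      (fun c b => by simp [← map_smul, hy]) (by rw [rowSum_mapRange, h0, map_zero])
    choose a ha using fun c b =>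
      (hfg (y c b)).1 (by simpa using DFunLike.congr_fun (congr_fun h1 c) b)
    let w : ∀ c, κ c →₀ A := fun c => Finsupp.onFinset (y c).support (a c) fun b hb => by
      rw [Finsupp.mem_support_iff, ← ha]
      exact (map_ne_zero_iff f hf).2 hb
    have hwy : (fun c => (w c).mapRange f f.map_zero) = y := by
      ext c b
      exact ha c b
    have hw : w = 0 := hA.inj w (fun c b => hf (by
        rw [map_smul]
        change e c • f (a c b) = f (a c b)
        rw [ha, hy])) (hf (by rw [← rowSum_mapRange, hwy, h0, map_zero]))
    rw [← hwy, hw]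
    ext
    simp

lemma HasRowDecomposition.congr (he : ∀ c, e c * e c = e c) (hB : HasRowDecomposition e u B)
    (i : X ≃ₗ[R] B) : HasRowDecomposition e u X :=
  .of_exact he (.of_subsingleton (X := PUnit.{1})) hB 0 i (Function.injective_of_subsingleton _)
    i.surjective fun x => by
      rw [LinearEquiv.coe_coe, i.map_eq_zero_iff]
      simp [eq_comm]

lemma HasRowDecomposition.of_chain {M : Type*} [AddCommGroup M] [Module R M]
    (he : ∀ c, e c * e c = e c) {F : ℕ → Submodule R M} {n : ℕ} (h0 : F 0 = ⊥) (hn : F n = ⊤)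
    (hle : ∀ k < n, F k ≤ F (k + 1))
    (h : ∀ k < n, HasRowDecomposition e u (Subquotient (F (k + 1)) (F k))) :
    HasRowDecomposition e u M := by
  have key : ∀ k ≤ n, HasRowDecomposition e u (F k) := by
    intro k
    induction k with
    | zero =>
      intro _
      rw [h0]
      exact .of_subsingleton
    | succ k ih =>
      intro hk
      refine .of_exact he (ih (by lia)) (h k hk) (Submodule.inclusion (hle k hk)) (Submodule.mkQ _)
        (Submodule.inclusion_injective _) (Submodule.mkQ_surjective _) ?_
      rw [LinearMap.exact_iff, Submodule.ker_mkQ, Submodule.range_inclusion]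
  have : Subsingleton (M ⧸ F n) := by
    rw [hn]
    infer_instance
  exact .of_exact he (key n le_rfl) (.of_subsingleton (X := M ⧸ F n)) (F n).subtype (F n).mkQ
    (F n).injective_subtype (F n).mkQ_surjective (LinearMap.exact_subtype_mkQ _)

lemma HasRowDecomposition.of_basis {c' : T} (β : Module.Basis (κ c') (Module.End R X) X) (b₀ : κ c')
    (he : ∀ q : X, e c' • q = β.coord b₀ q • β b₀) (he' : ∀ c ≠ c', ∀ q : X, e c • q = 0)
    (hu : ∀ b, u c' b • β b₀ = β b) : HasRowDecomposition e u X where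
  surj x := by
    classical
    refine ⟨Pi.single c' ((β.repr x).mapRange (fun d => d • β b₀) (zero_smul _ _)),
      fun c b => ?_, ?_⟩
    · obtain rfl | hc := eq_or_ne c c'
      · rw [Pi.single_eq_same, Finsupp.mapRange_apply, he, map_smul, β.coord_apply, β.repr_self,
          Finsupp.single_eq_same, smul_eq_mul, mul_one]
      · simp [hc]
    · rw [rowSum_apply, Finset.sum_eq_single c' (fun c _ hc => by simp [hc]) (by simp),
        Pi.single_eq_same, Finsupp.sum_mapRange_index (by simp)]
      conv_rhs => rw [← β.linearCombination_repr x, Finsupp.linearCombination_apply]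
      refine Finsupp.sum_congr fun b _ => ?_
      rw [← hu b, smul_comm]
  inj y hy h0 := by
    have hy' (c) (hc : c ≠ c') : y c = 0 := by
      ext b
      rw [← hy, he' c hc, Finsupp.zero_apply]
    let l := (y c').mapRange (β.coord b₀) (map_zero _)
    have hl (b) : y c' b = l b • β b₀ := by rw [← hy, he]; rfl
    have h1 : Finsupp.linearCombination (Module.End R X) β l = 0 := by
      rw [rowSum_apply, Finset.sum_eq_single c' (fun c _ hc => by simp [hy' c hc]) (by simp)] at h0
      rw [Finsupp.linearCombination_apply, Finsupp.sum_mapRange_index (by simp), ← h0]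
      refine Finsupp.sum_congr fun b _ => ?_
      change l b • β b = u c' b • y c' b
      rw [hl, ← hu b, smul_comm]
    have h2 := linearIndependent_iff.1 β.linearIndependent l h1
    ext c b
    obtain rfl | hc := eq_or_ne c c'
    · simp [hl, h2]
    · simp [hy' c hc]

end RowDecomposition

lemma isNilpotent_of_chain {R M : Type*} [Ring R] [AddCommGroup M] [Module R M] [FaithfulSMul R M]
    {F : ℕ → Submodule R M} {n : ℕ} (h0 : F 0 = ⊥) (hn : F n = ⊤) {r : R}
    (h : ∀ k < n, ∀ q : Subquotient (F (k + 1)) (F k), r • q = 0) : IsNilpotent r := by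
  have key : ∀ k ≤ n, ∀ x ∈ F k, r ^ k • x = 0 := by
    intro k
    induction k with
    | zero => simp [h0]
    | succ k ih =>
      intro hk x hx
      rw [pow_succ, mul_smul]
      refine ih (by lia) _ ?_
      have hh := h k hk (Submodule.mkQ _ ⟨x, hx⟩)
      rw [← map_smul] at hh
      have hx' := (Submodule.Quotient.mk_eq_zero _).1 hh
      exact hx'
  refine ⟨n, FaithfulSMul.eq_of_smul_eq_smul (α := M) fun x => ?_⟩
  rw [key n le_rfl x (by simp [hn]), zero_smul]

section Summands

variable {L M : Type*} [Ring L] [AddCommGroup M] [Module L M] {p : Module.End L M}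

lemma IsFiniteLength.range_of_isIdempotentElem (h : IsFiniteLength (Module.End L M) M)
    (hp : IsIdempotentElem p) :
    IsFiniteLength (Module.End L (LinearMap.range p)) (LinearMap.range p) := by
  let Φ (X : Submodule (Module.End L (LinearMap.range p)) (LinearMap.range p)) :
      Submodule (Module.End L M) M := Submodule.span _ ((↑) '' (X : Set (LinearMap.range p)))
  have hΦ (X) (x : LinearMap.range p) : (x : M) ∈ Φ X ↔ x ∈ X := by
    refine ⟨fun hx => ?_, fun hx => Submodule.subset_span ⟨x, hx, rfl⟩⟩
    have key (w : M) (hw : w ∈ Φ X) : ∀ f : Module.End L M, p.rangeRestrict (f w) ∈ X := by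
      induction hw using Submodule.span_induction with
      | mem w hw =>
        obtain ⟨y, hy, rfl⟩ := hw
        exact fun f => X.smul_mem (p.rangeRestrict ∘ₗ f ∘ₗ Submodule.subtype _) hy
      | zero => simp
      | add w w' _ _ h h' =>
        intro f
        rw [map_add, map_add]
        exact X.add_mem (h f) (h' f)
      | smul g w _ h => exact fun f => h (f * g)
    have hpx : p.rangeRestrict x = x := by
      obtain ⟨_, y, rfl⟩ := x
      exact Subtype.ext congr($hp y)
    simpa [hpx] using key x hx 1
  have hmono : StrictMono Φ := by
    refine Monotone.strictMono_of_injective (fun X Y hXY => Submodule.span_mono (by gcongr))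
      fun X Y hXY => ?_
    ext x
    rw [← hΦ, hXY, hΦ]
  rw [isFiniteLength_iff_isNoetherian_isArtinian] at h ⊢
  obtain ⟨h1, h2⟩ := h
  exact ⟨isNoetherian_iff'.2 hmono.wellFoundedGT, hmono.wellFoundedLT⟩

lemma modIndec_range {L M : Type} [Ring L] [AddCommGroup M] [Module L M] {p : Module.End L M}
    (hp : IsIdempotentElem p) (hp0 : p ≠ 0)
    (h : ∀ f : Module.End L M, f * f = f → p * f = f → f * p = f → f = 0 ∨ f = p) :
    ModIndec L (LinearMap.range p) := by
  have hpx (x : LinearMap.range p) : p.rangeRestrict x = x := by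
    obtain ⟨_, y, rfl⟩ := x
    exact Subtype.ext congr($hp y)
  refine ⟨Submodule.nontrivial_iff_ne_bot.2 (by rwa [Ne, LinearMap.range_eq_bot]), fun g hg => ?_⟩
  have hgx (x : LinearMap.range p) : g (g x) = g x := congr($hg x)
  have hpM (x : M) : p (p x) = p x := congr($hp x)
  have hpx' (x : LinearMap.range p) : p x = x := congrArg Subtype.val (hpx x)
  have hr (x : M) : p.rangeRestrict (p x) = p.rangeRestrict x := Subtype.ext (hpM x)
  rcases h (Submodule.subtype _ ∘ₗ g ∘ₗ p.rangeRestrict)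
    (by ext x; simp [hpx, hgx]) (by ext x; simp [hpx']) (by ext x; simp [hr]) with hf | hf
  · left
    ext x
    simpa [hpx] using congr($hf x)
  · right
    ext x
    simpa [hpx, hpx'] using congr($hf x)

end Summands

lemma Setoid.exists_fin_representatives {α : Type*} [Finite α] (s : Setoid α) :
    ∃ (t : ℕ) (σ : Fin t → α), (∀ i j, i ≠ j → ¬ s (σ i) (σ j)) ∧ ∀ a, ∃ i, s a (σ i) := by
  obtain ⟨t, ⟨E⟩⟩ := Finite.exists_equiv_fin (Quotient s)
  refine ⟨t, fun i => (E.symm i).out, fun i j hij h => hij ?_, fun a => ⟨E ⟦a⟧, ?_⟩⟩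
  · have := Quotient.sound h
    simpa using this
  · simpa using Setoid.symm (Quotient.mk_out a)

lemma IsSimpleModule.exists_basis_end (R S : Type*) [Ring R] [AddCommGroup S] [Module R S]
    [IsSimpleModule R S] :
    ∃ s : Set S, Nonempty s ∧ Nonempty (Module.Basis s (Module.End R S) S) := by
  classical
  have := IsSimpleModule.nontrivial R S
  let β := Module.Basis.ofVectorSpace (Module.End R S) S
  exact ⟨_, β.index_nonempty, ⟨β⟩⟩

/-- If a ring `R` acts densely on a finite family of simple modules and elements annihilating
all of them are nilpotent, then there are primitive idempotents acting as rank one projections on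
one member of the family and as zero on the others. -/
lemma exists_idempotents_hasRowDecomposition {R : Type*} [Ring R] {T : Type*} [Fintype T]
    {S : T → Type*} [∀ c, AddCommGroup (S c)] [∀ c, Module R (S c)] [∀ c, IsSimpleModule R (S c)]
    (hdense : ∀ φ : ∀ c, Module.End (Module.End R (S c)) (S c),
      ∃ r : R, ∀ c (q : S c), r • q = φ c q)
    (hnil : ∀ r : R, (∀ c (q : S c), r • q = 0) → IsNilpotent r) :
    ∃ (κ : ∀ c, Set (S c)) (e : T → R) (u : ∀ c, κ c → R),
      (∀ c, e c * e c = e c) ∧ (∀ c, e c ≠ 0) ∧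
      (∀ c f, f * f = f → e c * f = f → f * e c = f → f = 0 ∨ f = e c) ∧
      ∀ c, HasRowDecomposition e u (S c) := by
  classical
  choose κ b₀ β using fun c => IsSimpleModule.exists_basis_end R (S c)
  replace b₀ (c) : κ c := (b₀ c).some
  replace β (c) : Module.Basis (κ c) (Module.End R (S c)) (S c) := (β c).some
  let φ (c) : Module.End (Module.End R (S c)) (S c) :=
    LinearMap.toSpanSingleton _ _ (β c (b₀ c)) ∘ₗ (β c).coord (b₀ c)
  have hφ (c) (q : S c) : φ c q = (β c).coord (b₀ c) q • β c (b₀ c) := rfl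
  have hcoord (c) : (β c).coord (b₀ c) (β c (b₀ c)) = 1 := by
    rw [Module.Basis.coord_apply, Module.Basis.repr_self, Finsupp.single_eq_same]
  have hφφ (c) : φ c * φ c = φ c := by
    ext q
    rw [Module.End.mul_apply, hφ, hφ, map_smul, hcoord, smul_eq_mul, mul_one]
  let ψ (c) : ∀ c', Module.End (Module.End R (S c')) (S c') := Pi.single c (φ c)
  have hψψ (c) : ψ c * ψ c = ψ c := by rw [← Pi.single_mul, hφφ]
  have hnt (c) : Nontrivial (S c) := IsSimpleModule.nontrivial R (S c)
  have hβ0 (c) : β c (b₀ c) ≠ 0 := (β c).ne_zero _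
  let ρ : R →+* ∀ c, AddMonoid.End (S c) := RingHom.pi fun c => Module.toAddMonoidEnd R (S c)
  have hρ (r c) (q : S c) : ρ r c q = r • q := rfl
  have hker : ∀ r ∈ RingHom.ker ρ, IsNilpotent r := fun r hr => hnil r fun c q => by
    rw [← hρ, RingHom.mem_ker.1 hr]
    rfl
  have hidem (c : T) : ∃ e : R, e * e = e ∧ ∀ c' (q : S c'), e • q = ψ c c' q := by
    obtain ⟨r, hr⟩ := hdense (ψ c)
    obtain ⟨e, he, her⟩ := exists_isIdempotentElem_eq_of_ker_isNilpotent ρ hker (ρ r) ⟨r, rfl⟩ (by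
      ext c' q
      change r • r • q = r • q
      rw [hr, hr, ← Module.End.mul_apply, ← Pi.mul_apply, hψψ])
    exact ⟨e, he, fun c' q => by rw [← hr, ← hρ, her, hρ]⟩
  choose e he hes using hidem
  have hes_same (c) (q : S c) : e c • q = (β c).coord (b₀ c) q • β c (b₀ c) := by
    rw [hes, ← hφ, show ψ c c = φ c by simp [ψ]]
  have hes_ne (c c') (h : c' ≠ c) (q : S c') : e c • q = 0 := by
    rw [hes, show ψ c c' = 0 by simp [ψ, h], LinearMap.zero_apply]
  have heβ (c) : e c • β c (b₀ c) = β c (b₀ c) := by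
    rw [hes_same, hcoord, one_smul]
  choose u hu using fun c b => IsSimpleModule.toSpanSingleton_surjective R (hβ0 c) (β c b)
  have hzero (c : T) (f : R) (hf : f * f = f) (hfe : f * e c = f) (hfβ : f • β c (b₀ c) = 0) :
      f = 0 := by
    refine IsIdempotentElem.eq_zero_of_isNilpotent hf (hnil f fun c' q => ?_)
    rw [← hfe, mul_smul]
    obtain rfl | h := eq_or_ne c' c
    · rw [hes_same, smul_comm, hfβ, smul_zero]
    · rw [hes_ne c c' h, smul_zero]
  refine ⟨κ, e, u, he, fun c hc => hβ0 c ?_, fun c f hf hef hfe => ?_, fun c => ?_⟩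
  · rw [← heβ c, hc, zero_smul]
  · set d := (β c).coord (b₀ c) (f • β c (b₀ c)) with hd
    have hfd : f • β c (b₀ c) = d • β c (b₀ c) := by rw [← hes_same, smul_smul, hef]
    have hdd : IsIdempotentElem d := by
      have h := congrArg ((β c).coord (b₀ c)) (congrArg (· • β c (b₀ c)) hf)
      simp only [mul_smul] at h
      rwa [hfd, smul_comm, hfd, map_smul, map_smul, hcoord, smul_eq_mul, smul_eq_mul, mul_one] at h
    rcases IsIdempotentElem.iff_eq_zero_or_one.1 hdd with h | h
    · exact .inl (hzero c f hf hfe (by rw [hfd, h, zero_smul]))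
    · refine .inr (sub_eq_zero.1 (hzero c (e c - f) ?_ ?_ ?_)).symm
      · simp [mul_sub, sub_mul, he, hf, hef, hfe]
      · rw [sub_mul, he, hfe]
      · rw [sub_smul, heβ, hfd, h, one_smul, sub_self]
  · exact .of_basis (β c) (b₀ c) (hes_same c) (fun c' h => hes_ne c' c h.symm) (hu c)

/-- An endo-finite module has finitely many primitive idempotent endomorphisms whose images,
suitably translated, decompose the module. -/
lemma IsFiniteLength.exists_idempotents_hasRowDecomposition.{w, v} {L : Type w} {M : Type v}
    [Ring L] [AddCommGroup M] [Module L M] (hM : IsFiniteLength (Module.End L M) M) :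
    ∃ (t : ℕ) (κ : Fin t → Type v) (e : Fin t → Module.End L M) (u : ∀ c, κ c → Module.End L M),
      (∀ c, e c * e c = e c) ∧ (∀ c, e c ≠ 0) ∧
      (∀ c f, f * f = f → e c * f = f → f * e c = f → f = 0 ∨ f = e c) ∧
      HasRowDecomposition e u M := by
  obtain ⟨_, _⟩ := isFiniteLength_iff_isNoetherian_isArtinian.1 hM
  set E := Module.End L M
  obtain ⟨F, h0, n, hn, hcov⟩ :=
    exists_covBy_seq_of_wellFoundedLT_wellFoundedGT (Submodule E M)
  let Q (k : Fin n) := Subquotient (F (k + 1)) (F k)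
  have hsimple (k : Fin n) : IsSimpleModule E (Q k) :=
    (covBy_iff_quot_is_simple (hcov k k.2).le).1 (hcov k k.2)
  obtain ⟨t, σ, hσ, hσ'⟩ := Setoid.exists_fin_representatives
    { r := fun k l : Fin n => Nonempty (Q k ≃ₗ[E] Q l)
      iseqv := ⟨fun _ => ⟨.refl _ _⟩, fun ⟨i⟩ => ⟨i.symm⟩, fun ⟨i⟩ ⟨j⟩ => ⟨i.trans j⟩⟩ }
  have hiso (k : Fin n) : ∃ c, Nonempty (Q k ≃ₗ[E] Q (σ c)) := hσ' k
  have (c : Fin t) : IsSimpleModule E (Subquotient (F (σ c + 1)) (F (σ c))) := hsimple (σ c)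
  obtain ⟨κ, e, u, he, he0, hprim, hdec⟩ := _root_.exists_idempotents_hasRowDecomposition (R := E)
    (S := fun c => Subquotient (F (σ c + 1)) (F (σ c)))
    (Module.End.exists_smul_eq_of_subquotient (fun c => F (σ c + 1)) (fun c => F (σ c))
      fun c c' h => not_nonempty_iff.1 (hσ c c' h))
    (fun r hr => isNilpotent_of_chain h0.eq_bot hn.eq_top fun k hk q => by
      obtain ⟨c, ⟨i⟩⟩ := hiso ⟨k, hk⟩
      exact i.injective ((i.map_smul r q).trans ((hr c (i q)).trans i.map_zero.symm)))
  refine ⟨t, fun c => κ c, e, u, he, he0, hprim,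
    .of_chain he h0.eq_bot hn.eq_top (fun k hk => (hcov k hk).le) fun k hk => ?_⟩
  obtain ⟨c, ⟨i⟩⟩ := hiso ⟨k, hk⟩
  exact (hdec c).congr he i

lemma HasRowDecomposition.nonempty_linearEquiv {L M : Type*} [Ring L] [AddCommGroup M] [Module L M]
    {t : ℕ} {κ : Fin t → Type*} {e : Fin t → Module.End L M} {u : ∀ c, κ c → Module.End L M}
    (h : HasRowDecomposition e u M) (he : ∀ c, e c * e c = e c) :
    Nonempty (M ≃ₗ[L] DirectSum (Fin t) fun c => κ c →₀ LinearMap.range (e c)) := by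
  let Ψ : (∀ c, κ c →₀ LinearMap.range (e c)) →ₗ[L] M :=
    ∑ c, Finsupp.lsum ℕ (fun b => u c b ∘ₗ (LinearMap.range (e c)).subtype) ∘ₗ LinearMap.proj c
  let inc (z : ∀ c, κ c →₀ LinearMap.range (e c)) : ∀ c, κ c →₀ M :=
    fun c => (z c).mapRange (↑) rfl
  have hΨ (z) : Ψ z = rowSum u M (inc z) := by
    rw [rowSum_apply]
    simp only [Ψ, inc, LinearMap.sum_apply]
    refine Finset.sum_congr rfl fun c _ => ?_
    rw [Finsupp.sum_mapRange_index (by simp)]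
    rfl
  have hinc (z c b) : e c • inc z c b = inc z c b := by
    obtain ⟨y, hy⟩ := (z c b).2
    change e c (z c b : M) = z c b
    rw [← hy]
    exact congr($(he c) y)
  have hbij : Function.Bijective Ψ := by
    refine ⟨(injective_iff_map_eq_zero Ψ).2 fun z hz => ?_, fun x => ?_⟩
    · have h0 := h.inj (inc z) (hinc z) (by rw [← hΨ, hz])
      ext c b
      exact DFunLike.congr_fun (congr_fun h0 c) b
    · obtain ⟨y, hy, rfl⟩ := h.surj x
      refine ⟨fun c => (y c).mapRange (e c).rangeRestrict (map_zero _), ?_⟩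
      rw [hΨ]
      congr 1
      ext c b
      exact hy c b
  exact ⟨(LinearEquiv.ofBijective Ψ hbij).symm.trans
    (DirectSum.linearEquivFunOnFintype L _ _).symm⟩

/-- over a finite-dimensional hereditary algebra, every endo-finite module
is a direct sum of copies of finitely many indecomposable endo-finite modules. -/
theorem endo_finite_decomposition (k L : Type) [Field k] [Ring L] [Algebra k L]
    [FiniteDimensional k L] (hher : IsHereditaryRing L)
    (M : Type) [AddCommGroup M] [Module L M]
    (hM : IsFiniteLength (Module.End L M) M) :
    ∃ (t : ℕ) (N : Fin t → ModuleCat L),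
      (∀ i, ModIndec L ↥(N i)) ∧
      (∀ i, IsFiniteLength (Module.End L ↥(N i)) ↥(N i)) ∧
      ∃ κ : Fin t → Type, Nonempty (M ≃ₗ[L] DirectSum (Fin t) (fun i => κ i →₀ ↥(N i))) := by
  obtain ⟨t, κ, e, u, he, he0, hprim, hdec⟩ := hM.exists_idempotents_hasRowDecomposition
  exact ⟨t, fun c => ModuleCat.of L (LinearMap.range (e c)),
    fun c => modIndec_range (he c) (he0 c) (hprim c),
    fun c => hM.range_of_isIdempotentElem (he c), κ, hdec.nonempty_linearEquiv he⟩
end
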